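/- arXiv:2001.00547 — 2 statements merged into one kernel-verified Lean document; each statement's English description precedes it below -/
import Mathlib

section
/- The sum of all mixed multiplicities equals the total-degree multiplicity: let M be a finitely generated ℕ^r-graded B-module with d = dim(M) and let (Q_n) be a level-d decomposition of Hilb_M. Regard M as the ℕ-graded module M^gr over the standard graded algebra B^gr via total degree, so that Hilb_{M^gr}(s) = Hilb_M(s,…,s), and write (1−s)^d · Hilb_{M^gr}(s) = Q(s) with Q(s) ∈ ℤ[s]. Then Q(1) = ∑_{n∈ℕ^r, |n|=d} Q_n(1,…,1); that is, the multiplicity e(M^gr) of the single-graded module M^gr equals the sum of all mixed multiplicities of M. -/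
/-- The length of an `A`-module, as the height of `⊤` in its lattice of submodules. -/
noncomputable def modLength (A : Type) [CommRing A] (M : Type) [AddCommGroup M] [Module A M] : ℕ :=
  (Order.height (⊤ : Submodule A M)).toNat

section

variable {r : ℕ} {A B : Type} [CommRing A] [CommRing B] [Algebra A B]

/-- The multigraded Hilbert series of an `ℕ^r`-graded module with graded pieces `ℳ ν`. -/
noncomputable def hilbSeries {M : Type} [AddCommGroup M] [Module A M]
    (ℳ : (Fin r → ℕ) → Submodule A M) : MvPowerSeries (Fin r) ℤ :=
  fun ν => (modLength A ↥(ℳ ν) : ℤ)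

/-- The single-graded Hilbert series of `M^gr`, the module `M` regraded by total degree:
the coefficient of `s^m` is `∑_{|ν| = m} length_A (ℳ ν)`. -/
noncomputable def hilbSeriesGr {M : Type} [AddCommGroup M] [Module A M]
    (ℳ : (Fin r → ℕ) → Submodule A M) : PowerSeries ℤ :=
  PowerSeries.mk fun m =>
    ∑ ν ∈ Finset.filter (fun ν => ∑ i, ν i = m)
        (Fintype.piFinset fun _ : Fin r => Finset.range (m + 1)),
      (modLength A ↥(ℳ ν) : ℤ)

/-- Evaluation of an integer multivariate polynomial at `t₁ = ⋯ = t_r = 1`. -/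
noncomputable def evalOne {r : ℕ} (Q : MvPolynomial (Fin r) ℤ) : ℤ :=
  MvPolynomial.eval (fun _ => 1) Q

/-- A level-`D` decomposition of a power series `H`. -/
def IsLevelDecomposition {r : ℕ} (H : MvPowerSeries (Fin r) ℤ) (D : ℕ)
    (Q : (Fin r → ℕ) → MvPolynomial (Fin r) ℤ) : Prop :=
  (∀ nv : Fin r → ℕ, (∑ i, nv i) ≠ D → Q nv = 0) ∧
  ((∏ i : Fin r, (1 - MvPowerSeries.X i)) ^ D) * H =
    ∑ nv ∈ Finset.filter (fun nv => ∑ i, nv i = D)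
        (Fintype.piFinset fun _ : Fin r => Finset.range (D + 1)),
      (↑(Q nv) : MvPowerSeries (Fin r) ℤ) * ∏ i : Fin r, (1 - MvPowerSeries.X i) ^ (D - nv i)

/-- The ring homomorphism `ℤ⟦t₁, …, t_r⟧ → ℤ⟦s⟧` sending every `t_i` to `s`. -/
noncomputable def totalDegreeHom (r : ℕ) : MvPowerSeries (Fin r) ℤ →ₐ[ℤ] PowerSeries ℤ :=
  MvPowerSeries.rename (fun _ : Fin r => ())

theorem totalDegreeHom_X (i : Fin r) :
    totalDegreeHom r (MvPowerSeries.X i) = PowerSeries.X :=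
  MvPowerSeries.rename_X _ i

theorem totalDegreeHom_coe (P : MvPolynomial (Fin r) ℤ) :
    totalDegreeHom r (P : MvPowerSeries (Fin r) ℤ) =
      (MvPolynomial.aeval (fun _ => (Polynomial.X : Polynomial ℤ)) P : PowerSeries ℤ) := by
  induction P using MvPolynomial.induction_on with
  | C a =>
    rw [MvPolynomial.coe_C, MvPolynomial.aeval_C, Polynomial.algebraMap_apply, Polynomial.coe_C]
    exact MvPowerSeries.rename_C _ a
  | add p q hp hq => simp [hp, hq]
  | mul_X p i hp => simp [hp, totalDegreeHom_X]

theorem coeff_totalDegreeHom (H : MvPowerSeries (Fin r) ℤ) (m : ℕ) :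
    PowerSeries.coeff m (totalDegreeHom r H) =
      ∑ ν ∈ Finset.filter (fun ν => ∑ i, ν i = m)
          (Fintype.piFinset fun _ : Fin r => Finset.range (m + 1)),
        MvPowerSeries.coeff (Finsupp.equivFunOnFinite.symm ν) H := by
  rw [PowerSeries.coeff, totalDegreeHom, MvPowerSeries.coeff_rename]
  refine Finset.sum_nbij' (fun e => ⇑e) (fun ν => Finsupp.equivFunOnFinite.symm ν)
    ?_ ?_ ?_ ?_ ?_
  · intro e he
    have hsum : ∑ i, e i = m := by
      have h : Finsupp.mapDomain (fun _ => ()) e = Finsupp.single () m := by simpa using he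
      replace h := DFunLike.congr_fun h ()
      simpa [Finsupp.mapDomain, Finsupp.sum_fintype] using h
    simp only [Finset.mem_filter, Fintype.mem_piFinset, Finset.mem_range]
    refine ⟨fun i => ?_, hsum⟩
    have := Finset.single_le_sum (fun j _ => Nat.zero_le (e j)) (Finset.mem_univ i)
    lia
  · intro ν hν
    have hsum := (Finset.mem_filter.mp hν).2
    refine (Set.Finite.mem_toFinset _).mpr (Finsupp.ext fun _ => ?_)
    simpa [Finsupp.mapDomain, Finsupp.sum_fintype] using hsum
  · intro e _
    ext
    simp
  · intro ν _
    simp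
  · intro e _
    congr 2
    ext
    simp

theorem totalDegreeHom_hilbSeries {M : Type} [AddCommGroup M] [Module A M]
    (ℳ : (Fin r → ℕ) → Submodule A M) :
    totalDegreeHom r (hilbSeries ℳ) = hilbSeriesGr ℳ := by
  ext m
  rw [coeff_totalDegreeHom, hilbSeriesGr, PowerSeries.coeff_mk]
  rfl

theorem eval_one_aeval_X (P : MvPolynomial (Fin r) ℤ) :
    (MvPolynomial.aeval (fun _ => (Polynomial.X : Polynomial ℤ)) P).eval 1 = evalOne P := by
  induction P using MvPolynomial.induction_on with
  | C a => simp [evalOne]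
  | add p q hp hq => simp_all [evalOne]
  | mul_X p i hp => simp_all [evalOne]

theorem prod_pow_tsub_of_sum_eq {R : Type} [CommMonoid R] (x : R) {d : ℕ} {n : Fin r → ℕ}
    (hn : ∑ i, n i = d) :
    ∏ i, x ^ (d - n i) = x ^ (r * d - d) := by
  rw [Finset.prod_pow_eq_pow_sum]
  congr 1
  have hle : ∀ i, n i ≤ d := fun i =>
    hn ▸ Finset.single_le_sum (fun j _ => Nat.zero_le (n j)) (Finset.mem_univ i)
  have hadd : ∑ i, (d - n i) + ∑ i, n i = r * d := by
    rw [← Finset.sum_add_distrib]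
    simp [Nat.sub_add_cancel (hle _)]
  lia

/-- Setting all variables equal to `s` in a level-`d` decomposition. -/
theorem IsLevelDecomposition.totalDegreeHom_eq {H : MvPowerSeries (Fin r) ℤ} {d : ℕ}
    {Q : (Fin r → ℕ) → MvPolynomial (Fin r) ℤ} (hQ : IsLevelDecomposition H d Q) (hr : 0 < r) :
    (1 - PowerSeries.X) ^ d * totalDegreeHom r H =
      ((∑ n ∈ Finset.filter (fun n => ∑ i, n i = d)
          (Fintype.piFinset fun _ : Fin r => Finset.range (d + 1)),
        MvPolynomial.aeval (fun _ => (Polynomial.X : Polynomial ℤ)) (Q n) : Polynomial ℤ) :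
          PowerSeries ℤ) := by
  have hne : (1 - PowerSeries.X : PowerSeries ℤ) ≠ 0 := fun h => by
    simpa using congrArg PowerSeries.constantCoeff h
  have key := congrArg (totalDegreeHom r) hQ.2
  simp only [map_mul, map_pow, map_prod, map_sub, map_one, map_sum, totalDegreeHom_X,
    totalDegreeHom_coe, Finset.prod_const, Finset.card_univ, Fintype.card_fin] at key
  rw [Finset.sum_congr rfl fun n hn => by
    rw [prod_pow_tsub_of_sum_eq _ (Finset.mem_filter.mp hn).2], ← Finset.sum_mul] at key
  have hpow : r * d = (r * d - d) + d := (Nat.sub_add_cancel (Nat.le_mul_of_pos_left d hr)).symm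
  rw [← pow_mul] at key
  conv_lhs at key => rw [hpow, pow_add, mul_assoc]
  rw [mul_comm (∑ _ ∈ _, _)] at key
  rw [mul_left_cancel₀ (pow_ne_zero _ hne) key]
  exact (map_sum (Polynomial.coeToPowerSeries.ringHom (R := ℤ)) _ _).symm

/-- **The sum of all mixed multiplicities equals the total-degree multiplicity**
(Theorem 2.7(i)).  Let `M` be a finitely generated `ℕ^r`-graded `B`-module with `d = dim M`
and `(Q_n)` a level-`d` decomposition of `Hilb_M`.  Writing
`(1-s)^d · Hilb_{M^gr}(s) = Q(s)` with `Q(s) ∈ ℤ[s]`, one has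
`Q(1) = ∑_{|n| = d} Q_n(1,…,1)`, i.e. `e(M^gr)` is the sum of all mixed multiplicities. -/
theorem multiplicity_gr_eq_sum_mixed
    (hr : 0 < r) [IsArtinianRing A] [IsLocalRing A]
    (𝒜 : (Fin r → ℕ) → Submodule A B) [GradedAlgebra 𝒜]
    (hstd : Algebra.adjoin A (⋃ i : Fin r, ((𝒜 (Pi.single i 1) : Submodule A B) : Set B)) = ⊤)
    {M : Type} [AddCommGroup M] [Module A M] [Module B M] [IsScalarTower A B M]
    (ℳ : (Fin r → ℕ) → Submodule A M) [SetLike.GradedSMul 𝒜 ℳ] [DirectSum.Decomposition ℳ]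
    [Module.Finite B M]
    (d : ℕ) (hd : ringKrullDim (B ⧸ Module.annihilator B M) = (d : ℕ))
    (Q : (Fin r → ℕ) → MvPolynomial (Fin r) ℤ)
    (hQ : IsLevelDecomposition (hilbSeries ℳ) d Q)
    (Qs : Polynomial ℤ)
    (hQs : (1 - PowerSeries.X) ^ d * hilbSeriesGr ℳ = (↑Qs : PowerSeries ℤ)) :
    Qs.eval 1 =
      ∑ nv ∈ Finset.filter (fun nv => ∑ i, nv i = d)
          (Fintype.piFinset fun _ : Fin r => Finset.range (d + 1)),
        evalOne (Q nv) := by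
  rw [← totalDegreeHom_hilbSeries, hQ.totalDegreeHom_eq hr, Polynomial.coe_inj] at hQs
  rw [← hQs, Polynomial.eval_finsetSum]
  exact Finset.sum_congr rfl fun n _ => eval_one_aeval_X (Q n)

end
end

section
/- Reduction of projective degrees to Rees algebras over linear sections: assume k is an infinite field. Then there exist linear forms h_1,…,h_d ∈ [R]_1 such that for every 0 ≤ i ≤ d, setting S_i = R/(h_1,…,h_i) and J_i = I·S_i, the bigraded Hilbert function H_i(j,q) = dim_k [J_i^q]_{j+qδ} (degree computed in the standard graded ring S_i) agrees for all (j,q) ≫ (0,0) with a polynomial P_i(u,v) ∈ ℚ[u,v] of total degree at most d−i, and d_i(F) = (d−i)! times the coefficient of u^0 v^{d−i} in P_i; that is, d_i(F) equals the mixed multiplicity e(0, d−i; Rees_{S_i}(J_i)) of the Rees algebra of J_i over S_i. -/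
set_option synthInstance.maxHeartbeats 1000000

section

variable {d : ℕ} (k : Type) [Field k]

/-- The bigraded Hilbert function of the Rees algebra of `I = (f₀,…,f_n)`:
`H(j,q) = dim_k [I^q]_{j+qδ}`. -/
noncomputable def reesHilbFn {n : ℕ} (δ : ℕ)
    (f : Fin (n + 1) → MvPolynomial (Fin (d + 1)) k) (j q : ℕ) : ℕ :=
  Module.finrank k
    ↥(((Ideal.span (Set.range f)) ^ q).restrictScalars k ⊓
      MvPolynomial.homogeneousSubmodule (Fin (d + 1)) k (j + q * δ))

/-- `P ∈ ℚ[u,v]` agrees with the bigraded function `H` for all `(j,q) ≫ (0,0)`. -/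
def IsBigradedHilbPoly (H : ℕ → ℕ → ℕ) (P : MvPolynomial (Fin 2) ℚ) : Prop :=
  ∃ j₀ q₀ : ℕ, ∀ j q : ℕ, j₀ ≤ j → q₀ ≤ q →
    MvPolynomial.eval ![(j : ℚ), (q : ℚ)] P = (H j q : ℚ)

/-- The `i`-th projective degree `d_i(F) = i!(d−i)!` times the coefficient of
`u^i v^{d-i}` in the bigraded Hilbert polynomial `P` of the Rees algebra. -/
noncomputable def projDeg (d : ℕ) (P : MvPolynomial (Fin 2) ℚ) (i : ℕ) : ℚ :=
  ((Nat.factorial i : ℚ) * (Nat.factorial (d - i) : ℚ)) *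
    MvPolynomial.coeff (Finsupp.single (0 : Fin 2) i + Finsupp.single (1 : Fin 2) (d - i)) P

/-- The bigraded Hilbert function `(j,q) ↦ dim_k [J^q]_{j+qδ}` of the Rees algebra of the
ideal `J = I·S` in the linear section `S = R/(h₁,…,h_i)`, where degrees in `S` are computed
as images of the homogeneous components of `R`. -/
noncomputable def reesHilbFnSection {n : ℕ} (δ : ℕ)
    (f : Fin (n + 1) → MvPolynomial (Fin (d + 1)) k)
    (Hi : Ideal (MvPolynomial (Fin (d + 1)) k)) (j q : ℕ) : ℕ :=
  Module.finrank k
    ↥((((Ideal.span (Set.range f)).map (Ideal.Quotient.mk Hi)) ^ q).restrictScalars k ⊓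
      Submodule.map (Ideal.Quotient.mkₐ k Hi).toLinearMap
        (MvPolynomial.homogeneousSubmodule (Fin (d + 1)) k (j + q * δ)))

end

/-- A subspace over an infinite field contains an element lying only in those members of a given
finite family of ideals that contain the whole subspace. -/
theorem Submodule.exists_mem_forall_mem_ideal_imp_le (k : Type*) [Field k] [Infinite k]
    {R : Type*} [CommRing R] [Algebra k R] (V : Submodule k R) {S : Set (Ideal R)}
    (hS : S.Finite) :
    ∃ h ∈ V, ∀ p ∈ S, h ∈ p → ∀ v ∈ V, v ∈ p := by
  classical
  let W : Ideal R → Submodule k V := fun p => (p.restrictScalars k).comap V.subtype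
  let T : Finset (Submodule k V) := (hS.toFinset.image W).filter (· ≠ ⊤)
  have hT : (⊤ : Submodule k V) ∉ T := by simp [T]
  have hne := Subspace.biUnion_ne_univ_of_top_notMem hT
  obtain ⟨x, hx⟩ := (Set.ne_univ_iff_exists_notMem _).1 hne
  refine ⟨x, x.2, fun p hp hxp v hv => ?_⟩
  by_contra hvp
  apply hx
  refine Set.mem_biUnion (x := W p) ?_ hxp
  have : W p ≠ ⊤ := fun h => hvp (show (⟨v, hv⟩ : V) ∈ W p by rw [h]; trivial)
  simp only [T, Finset.coe_filter, Set.mem_ofPred_eq, Finset.mem_image, Set.Finite.mem_toFinset]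
  exact ⟨⟨p, hp, rfl⟩, this⟩

/-- If every associated prime of a Noetherian module `N` contains `a`, then a power of `a`
annihilates `N`. -/
theorem exists_pow_smul_eq_zero_of_forall_mem_associatedPrimes {B N : Type*} [CommRing B]
    [IsNoetherianRing B] [AddCommGroup N] [Module B N] [Module.Finite B N] (a : B)
    (ha : ∀ p ∈ associatedPrimes B N, a ∈ p) : ∃ n : ℕ, ∀ x : N, a ^ n • x = 0 := by
  have : IsNoetherian B N := isNoetherian_of_isNoetherianRing_of_finite B N
  let L : Module.End B N := LinearMap.lsmul B N a
  have hL : ∀ (n : ℕ) (x : N), (L ^ n) x = a ^ n • x := by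
    intro n
    induction n with
    | zero => intro x; simp
    | succ n ih => intro x; rw [pow_succ', Module.End.mul_apply, ih, pow_succ', mul_smul]; rfl
  obtain ⟨n, hn⟩ := monotone_stabilizes_iff_noetherian.2 this
    ⟨fun n => LinearMap.ker (L ^ n), fun m n hmn x hx => by
      rw [LinearMap.mem_ker, hL] at hx ⊢
      rw [← Nat.sub_add_cancel hmn, pow_add, mul_smul, hx, smul_zero]⟩
  refine ⟨n, ?_⟩
  by_contra! hcon
  obtain ⟨x, hx⟩ := hcon
  let N' : Submodule B N := LinearMap.range (L ^ n)
  have : Nontrivial N' := ⟨⟨⟨(L ^ n) x, x, rfl⟩, 0, fun h => hx (by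
    rw [← hL]; exact congrArg Subtype.val h)⟩⟩
  obtain ⟨p, hp⟩ := associatedPrimes.nonempty B N'
  have hap : a ∈ p := ha p (associatedPrimes.subset_of_injective N'.injective_subtype hp)
  obtain ⟨hprime, ⟨⟨_, z, rfl⟩, hw⟩⟩ := (isAssociatedPrime_iff (R := B)).1 hp
  have h1 : a • (⟨(L ^ n) z, z, rfl⟩ : N') = 0 := by
    rw [hw] at hap; simpa [Submodule.mem_colon_singleton] using hap
  have h2 : a ^ (n + 1) • z = 0 := by
    rw [pow_succ', mul_smul, ← hL]; exact congrArg Subtype.val h1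
  have h3 : z ∈ LinearMap.ker (L ^ n) := by
    have h5 : LinearMap.ker (L ^ n) = LinearMap.ker (L ^ (n + 1)) := hn (n + 1) (Nat.le_succ n)
    rw [h5, LinearMap.mem_ker, hL, h2]
  apply hprime.ne_top
  rw [hw, Ideal.eq_top_iff_one]
  have h4 : (⟨(L ^ n) z, z, rfl⟩ : N') = 0 := Subtype.ext h3
  rw [h4]
  simp

/-- **Existence of filter-regular elements.** Over an infinite field, a subspace `V` of `R`
contains an element `h` such that multiplication by `h` is injective on `𝔪 ^ c M`, where `𝔪` is an
ideal generated by elements of `V`. -/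
theorem exists_filterRegular (k : Type*) [Field k] [Infinite k]
    {R B M : Type*} [CommRing R] [Algebra k R] [CommRing B] [IsNoetherianRing B] [Algebra R B]
    [AddCommGroup M] [Module B M] [Module.Finite B M] (V : Submodule k R) {s : Set R}
    (hs : s ⊆ V) :
    ∃ h ∈ V, ∃ c : ℕ, ∀ x ∈ (((Ideal.span s).map (algebraMap R B)) ^ c • ⊤ : Submodule B M),
      algebraMap R B h • x = 0 → x = 0 := by
  obtain ⟨h, hV, hh⟩ := V.exists_mem_forall_mem_ideal_imp_le k
    ((associatedPrimes.finite B M).image (Ideal.comap (algebraMap R B)))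
  refine ⟨h, hV, ?_⟩
  set 𝔪 := (Ideal.span s).map (algebraMap R B)
  let N : Submodule B M := LinearMap.ker (LinearMap.lsmul B M (algebraMap R B h))
  have hN : ∀ x : M, x ∈ N ↔ algebraMap R B h • x = 0 := fun x => Iff.rfl
  have hrad : 𝔪 ≤ (Module.annihilator B N).radical := by
    rw [Ideal.map_le_iff_le_comap, Ideal.span_le]
    intro v hv
    have : IsNoetherian B M := isNoetherian_of_isNoetherianRing_of_finite B M
    obtain ⟨n, hn⟩ := exists_pow_smul_eq_zero_of_forall_mem_associatedPrimes (N := N)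
      (algebraMap R B v) (by
        intro p hp
        refine hh _ ⟨p, associatedPrimes.subset_of_injective N.injective_subtype hp, rfl⟩ ?_ v
          (hs hv)
        rw [Ideal.mem_comap]
        apply IsAssociatedPrime.annihilator_le hp
        rw [Module.mem_annihilator]
        exact fun x => Subtype.ext (Subtype.ext x.1.2))
    exact ⟨n, Module.mem_annihilator.2 hn⟩
  obtain ⟨e, he⟩ := Ideal.exists_pow_le_of_le_radical_of_fg hrad (IsNoetherian.noetherian 𝔪)
  obtain ⟨c, hc⟩ := 𝔪.exists_pow_inf_eq_pow_smul N
  refine ⟨c + e, fun x hx hhx => ?_⟩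
  have hx' : x ∈ (𝔪 ^ (c + e) • ⊤ : Submodule B M) ⊓ N := ⟨hx, hhx⟩
  rw [hc _ (Nat.le_add_right c e), Nat.add_sub_cancel_left] at hx'
  have : 𝔪 ^ e • (𝔪 ^ c • ⊤ ⊓ N) ≤ (⊥ : Submodule B M) := by
    rw [Submodule.smul_le]
    intro r hr y hy
    exact congrArg Subtype.val (Module.mem_annihilator.1 (he hr) ⟨y, hy.2⟩)
  simpa using this hx'

/-- The ideal of the Rees algebra of `I` of elements whose `q`-th coefficient lies in `L q`. -/
def reesAlgebra.idealOfCoeff {R : Type*} [CommRing R] (I : Ideal R) (L : ℕ → Ideal R)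
    (hL : ∀ p q, I ^ p * L q ≤ L (p + q)) : Ideal (reesAlgebra I) where
  carrier := {z | ∀ q, (z : Polynomial R).coeff q ∈ L q}
  zero_mem' q := by simp
  add_mem' hx hy q := by simpa using add_mem (hx q) (hy q)
  smul_mem' c x hx q := by
    simp only [smul_eq_mul, MulMemClass.coe_mul, Polynomial.coeff_mul]
    refine sum_mem fun ij hij => ?_
    rw [← Finset.HasAntidiagonal.mem_antidiagonal.1 hij]
    exact hL _ _ (Ideal.mul_mem_mul (c.2 _) (hx _))

theorem reesAlgebra.monomial_mem_idealOfCoeff_iff {R : Type*} [CommRing R] {I : Ideal R}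
    {L : ℕ → Ideal R} {hL : ∀ p q, I ^ p * L q ≤ L (p + q)} {p : ℕ} {y : R} (hy : y ∈ I ^ p) :
    (⟨Polynomial.monomial p y, reesAlgebra.monomial_mem.2 hy⟩ : reesAlgebra I) ∈
      reesAlgebra.idealOfCoeff I L hL ↔ y ∈ L p := by
  constructor
  · intro h
    simpa using h p
  · intro h q
    simp only [Polynomial.coeff_monomial]
    split_ifs with hq
    · exact hq ▸ h
    · exact zero_mem _

theorem reesAlgebra.monomial_mem_map_of_mem_mul {R : Type*} [CommRing R] {I J : Ideal R}
    {p : ℕ} {y : R} (hy : y ∈ I ^ p) (hyJ : y ∈ J * I ^ p) :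
    (⟨Polynomial.monomial p y, reesAlgebra.monomial_mem.2 hy⟩ : reesAlgebra I) ∈
      J.map (algebraMap R (reesAlgebra I)) := by
  have key : ∀ z ∈ J * I ^ p, ∃ hz : z ∈ I ^ p,
      (⟨Polynomial.monomial p z, reesAlgebra.monomial_mem.2 hz⟩ : reesAlgebra I) ∈
        J.map (algebraMap R (reesAlgebra I)) := by
    intro z hz
    induction hz using Submodule.mul_induction_on' with
    | mem_mul_mem a ha b hb =>
      refine ⟨Ideal.mul_mem_left _ _ hb, ?_⟩
      have : (⟨Polynomial.monomial p (a * b), reesAlgebra.monomial_mem.2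
          (Ideal.mul_mem_left _ _ hb)⟩ : reesAlgebra I) =
          algebraMap R (reesAlgebra I) a *
            ⟨Polynomial.monomial p b, reesAlgebra.monomial_mem.2 hb⟩ := by
        apply Subtype.ext
        exact (Polynomial.C_mul_monomial).symm
      rw [this]
      exact Ideal.mul_mem_right _ _ (Ideal.mem_map_of_mem _ ha)
    | add a ha b hb iha ihb =>
      obtain ⟨ha', iha⟩ := iha
      obtain ⟨hb', ihb⟩ := ihb
      refine ⟨add_mem ha' hb', ?_⟩
      convert add_mem iha ihb using 1
      exact Subtype.ext (map_add (Polynomial.monomial p) a b)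
  exact (key y hyJ).2

/-- A filter-regular element for two cyclic modules simultaneously. -/
theorem exists_filterRegular_ideal_pair (k : Type*) [Field k] [Infinite k]
    {R B : Type*} [CommRing R] [Algebra k R] [CommRing B] [IsNoetherianRing B] [Algebra R B]
    (V : Submodule k R) {s : Set R} (hs : s ⊆ V) (K₁ K₂ : Ideal B) :
    ∃ h ∈ V, ∃ c : ℕ, ∀ z ∈ (Ideal.span s ^ c).map (algebraMap R B),
      (algebraMap R B h * z ∈ K₁ → z ∈ K₁) ∧ (algebraMap R B h * z ∈ K₂ → z ∈ K₂) := by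
  obtain ⟨h, hV, c, hc⟩ := exists_filterRegular k (B := B) (M := (B ⧸ K₁) × (B ⧸ K₂)) V hs
  rw [← Ideal.map_pow] at hc
  refine ⟨h, hV, c, fun z hz => ⟨fun hhz => ?_, fun hhz => ?_⟩⟩
  · have h1 := hc (z • (1, 0)) (Submodule.smul_mem_smul hz trivial) (by
      rw [← mul_smul]
      refine Prod.ext ?_ (smul_zero _)
      rw [Prod.smul_mk, Prod.fst_zero, Algebra.smul_def, mul_one]
      exact Ideal.Quotient.eq_zero_iff_mem.2 hhz)
    have h2 : z • (1 : B ⧸ K₁) = 0 := congrArg Prod.fst h1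
    rw [Algebra.smul_def, mul_one] at h2
    exact Ideal.Quotient.eq_zero_iff_mem.1 h2
  · have h1 := hc (z • (0, 1)) (Submodule.smul_mem_smul hz trivial) (by
      rw [← mul_smul]
      refine Prod.ext (smul_zero _) ?_
      change _ • (1 : B ⧸ K₂) = 0
      rw [Algebra.smul_def, mul_one]
      exact Ideal.Quotient.eq_zero_iff_mem.2 hhz)
    have h2 : z • (1 : B ⧸ K₂) = 0 := congrArg Prod.snd h1
    rw [Algebra.smul_def, mul_one] at h2
    exact Ideal.Quotient.eq_zero_iff_mem.1 h2

/-- Existence of an element of `V` that is simultaneously filter-regular on `R ⧸ 𝔞` and on the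
associated graded ring of the image of `I` in `R ⧸ 𝔞`. -/
theorem exists_filterRegular_associatedGraded (k : Type*) [Field k] [Infinite k]
    {R : Type*} [CommRing R] [IsNoetherianRing R] [Algebra k R] (V : Submodule k R) {s : Set R}
    (hs : s ⊆ V) (I 𝔞 : Ideal R) :
    ∃ h ∈ V, ∃ c : ℕ,
      (∀ p, ∀ y ∈ Ideal.span s ^ c * I ^ p, h * y ∈ I ^ (p + 1) ⊔ 𝔞 → y ∈ I ^ (p + 1) ⊔ 𝔞) ∧
      ∀ y ∈ Ideal.span s ^ c, h * y ∈ 𝔞 → y ∈ 𝔞 := by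
  let L : ℕ → Ideal R := fun q => I ^ (q + 1) ⊔ 𝔞
  have hL : ∀ p q, I ^ p * L q ≤ L (p + q) := fun p q => by
    simp only [L]
    rw [Ideal.mul_sup, ← pow_add, add_assoc]
    exact sup_le_sup_left Ideal.mul_le_right _
  let L' : ℕ → Ideal R := fun _ => 𝔞
  have hL' : ∀ p q, I ^ p * L' q ≤ L' (p + q) := fun p q => Ideal.mul_le_right
  obtain ⟨h, hV, c, hc⟩ := exists_filterRegular_ideal_pair k (B := reesAlgebra I) V hs
    (reesAlgebra.idealOfCoeff I L hL) (reesAlgebra.idealOfCoeff I L' hL')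
  have hmul : ∀ p (y : R) (hy : y ∈ I ^ p), algebraMap R (reesAlgebra I) h *
      (⟨Polynomial.monomial p y, reesAlgebra.monomial_mem.2 hy⟩ : reesAlgebra I) =
      ⟨Polynomial.monomial p (h * y), reesAlgebra.monomial_mem.2 (Ideal.mul_mem_left _ _ hy)⟩ :=
    fun p y hy => Subtype.ext Polynomial.C_mul_monomial
  refine ⟨h, hV, c, fun p y hy hhy => ?_, fun y hy hhy => ?_⟩
  · have hy' : y ∈ I ^ p := Ideal.mul_le_right hy
    have h1 := (hc _ (reesAlgebra.monomial_mem_map_of_mem_mul hy' hy)).1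
    rw [hmul _ _ hy', reesAlgebra.monomial_mem_idealOfCoeff_iff hy',
      reesAlgebra.monomial_mem_idealOfCoeff_iff (Ideal.mul_mem_left _ _ hy')] at h1
    exact h1 hhy
  · have hy' : y ∈ I ^ 0 := by simp
    have h1 := (hc _ (reesAlgebra.monomial_mem_map_of_mem_mul hy' (by simpa using hy))).2
    rw [hmul _ _ hy', reesAlgebra.monomial_mem_idealOfCoeff_iff hy',
      reesAlgebra.monomial_mem_idealOfCoeff_iff (Ideal.mul_mem_left _ _ hy')] at h1
    exact h1 hhy

section

open MvPolynomial
open scoped Pointwise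

attribute [local instance] MvPolynomial.gradedAlgebra

namespace MvPolynomial

variable {σ k : Type*} [Field k]

theorem homogeneousComponent_mul_of_le {a g : MvPolynomial σ k} {e m : ℕ}
    (hg : g.IsHomogeneous e) (hem : e ≤ m) :
    homogeneousComponent m (a * g) = homogeneousComponent (m - e) a * g := by
  have := DirectSum.coe_decompose_mul_of_right_mem_of_le (homogeneousSubmodule σ k) (a := a)
    (show g ∈ homogeneousSubmodule σ k e from hg) hem
  rw [← decomposition.decompose'_apply, ← decomposition.decompose'_apply]
  exact this

theorem homogeneousComponent_mem_pow_idealOfVars (a : MvPolynomial σ k) {c m : ℕ} (h : c ≤ m) :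
    homogeneousComponent m a ∈ idealOfVars σ k ^ c := by
  rw [mem_pow_idealOfVars_iff']
  intro x hx
  rw [coeff_homogeneousComponent, if_neg (by omega)]

theorem isHomogeneous_of_mem_range_pow {ι : Type*} {δ : ℕ} {f : ι → MvPolynomial σ k}
    (hf : ∀ j, (f j).IsHomogeneous δ) (p : ℕ) :
    ∀ g ∈ Set.range f ^ p, g.IsHomogeneous (p * δ) := by
  induction p with
  | zero => rintro g hg; simp at hg; subst hg; simpa using isHomogeneous_one σ k
  | succ p ih =>
    intro g hg
    rw [pow_succ] at hg
    obtain ⟨a, ha, _, ⟨j, rfl⟩, rfl⟩ := hg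
    rw [Nat.succ_mul]
    exact (ih a ha).mul (hf j)

theorem homogeneousComponent_mem_mul_span_pow {ι : Type*} {δ : ℕ} {f : ι → MvPolynomial σ k}
    (hf : ∀ j, (f j).IsHomogeneous δ) {p c m : ℕ} (hm : c + p * δ ≤ m) {y : MvPolynomial σ k}
    (hy : y ∈ Ideal.span (Set.range f) ^ p) :
    homogeneousComponent m y ∈ idealOfVars σ k ^ c * Ideal.span (Set.range f) ^ p := by
  have hspan : Ideal.span (Set.range f) ^ p = Ideal.span (Set.range f ^ p) :=
    Submodule.span_pow (Set.range f) p
  rw [hspan] at hy ⊢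
  induction hy using Submodule.span_induction with
  | mem g hg =>
    have := homogeneousComponent_mul_of_le (a := 1) (isHomogeneous_of_mem_range_pow hf p g hg)
      (show p * δ ≤ m by omega)
    rw [one_mul] at this
    rw [this]
    exact Ideal.mul_mem_mul (homogeneousComponent_mem_pow_idealOfVars _ (by omega))
      (Ideal.subset_span hg)
  | zero => simp
  | add x y _ _ hx hy => rw [map_add]; exact add_mem hx hy
  | smul a x hx' hx =>
    clear hx
    induction hx' using Submodule.span_induction generalizing a with
    | mem g hg =>
      rw [smul_eq_mul, homogeneousComponent_mul_of_le (isHomogeneous_of_mem_range_pow hf p g hg)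
        (show p * δ ≤ m by omega)]
      exact Ideal.mul_mem_mul (homogeneousComponent_mem_pow_idealOfVars _ (by omega))
        (Ideal.subset_span hg)
    | zero => simp
    | add x y _ _ hx hy => rw [smul_add, map_add]; exact add_mem (hx a) (hy a)
    | smul b x _ hx => rw [smul_smul]; exact hx _

theorem exists_linearForm_filterRegular [Finite σ] [Infinite k] {ι : Type*} {δ : ℕ}
    {f : ι → MvPolynomial σ k} (hf : ∀ j, (f j).IsHomogeneous δ) {𝔞 : Ideal (MvPolynomial σ k)}
    (h𝔞 : 𝔞.IsHomogeneous (homogeneousSubmodule σ k)) :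
    ∃ h : MvPolynomial σ k, h.IsHomogeneous 1 ∧ ∃ c : ℕ, ∀ m x, x.IsHomogeneous m →
      (∀ q, c + q * δ ≤ m → h * x ∈ Ideal.span (Set.range f) ^ q ⊔ 𝔞 →
        x ∈ Ideal.span (Set.range f) ^ q ⊔ 𝔞) ∧
      (c ≤ m → h * x ∈ 𝔞 → x ∈ 𝔞) := by
  obtain ⟨h, hh, c, hc, hc'⟩ := exists_filterRegular_associatedGraded k
    (homogeneousSubmodule σ k 1) (s := Set.range X)
    (by rintro _ ⟨i, rfl⟩; exact isHomogeneous_X k i) (Ideal.span (Set.range f)) 𝔞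
  set I := Ideal.span (Set.range f)
  refine ⟨h, hh, c, fun m x hx => ⟨fun q hq hhx => ?_, fun hm => hc' x ?_⟩⟩
  · have key : ∀ p ≤ q, x ∈ I ^ p ⊔ 𝔞 := by
      intro p
      induction p with
      | zero => intro _; simp
      | succ p ih =>
        intro hp
        obtain ⟨y, hy, a, ha, hya⟩ := Submodule.mem_sup.1 (ih (by omega))
        have hxya : x = homogeneousComponent m y + homogeneousComponent m a := by
          rw [← map_add, hya, homogeneousComponent_eq_self hx]
        have ha' : homogeneousComponent m a ∈ 𝔞 := homogeneousComponent_mem_of_mem h𝔞 ha m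
        have hpq : p * δ ≤ q * δ := Nat.mul_le_mul_right _ (by omega)
        have hy' := homogeneousComponent_mem_mul_span_pow hf (c := c) (m := m) (by omega) hy
        rw [hxya]
        refine add_mem (hc p _ hy' ?_) (Ideal.mem_sup_right ha')
        have e : h * homogeneousComponent m y = h * x - h * homogeneousComponent m a := by
          rw [hxya]; ring
        rw [e]
        refine sub_mem (sup_le_sup_right (Ideal.pow_le_pow_right hp) 𝔞 hhx)
          (Ideal.mem_sup_right (Ideal.mul_mem_left _ _ ha'))
    exact key q le_rfl
  · have := homogeneousComponent_mem_pow_idealOfVars x hm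
    rwa [homogeneousComponent_eq_self hx] at this

/-- The degree `m` piece of an ideal of a polynomial ring, as a vector space. -/
noncomputable abbrev idealDegreePart (𝔟 : Ideal (MvPolynomial σ k)) (m : ℕ) :
    Submodule k (MvPolynomial σ k) :=
  𝔟.restrictScalars k ⊓ homogeneousSubmodule σ k m

instance [Finite σ] (m : ℕ) : Module.Finite k (homogeneousSubmodule σ k m) :=
  Module.Finite.iff_fg.2 (homogeneousSubmodule_fg σ k m)

instance [Finite σ] (𝔟 : Ideal (MvPolynomial σ k)) (m : ℕ) :
    Module.Finite k (idealDegreePart 𝔟 m) :=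
  Submodule.finiteDimensional_inf_right _ _

theorem idealDegreePart_sup_span_singleton {h : MvPolynomial σ k} (hh : h.IsHomogeneous 1)
    {𝔟 : Ideal (MvPolynomial σ k)} (h𝔟 : 𝔟.IsHomogeneous (homogeneousSubmodule σ k)) (m : ℕ) :
    idealDegreePart (𝔟 ⊔ Ideal.span {h}) (m + 1) =
      idealDegreePart 𝔟 (m + 1) ⊔ (homogeneousSubmodule σ k m).map (LinearMap.mulLeft k h) := by
  apply le_antisymm
  · rintro x ⟨hx, hxm⟩
    obtain ⟨b, hb, y, hy, hby⟩ := Submodule.mem_sup.1 hx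
    obtain ⟨a, rfl⟩ := Ideal.mem_span_singleton'.1 hy
    have : x = homogeneousComponent (m + 1) b + h * homogeneousComponent m a := by
      have h1 := homogeneousComponent_mul_of_le (a := a) hh (show 1 ≤ m + 1 by omega)
      rw [Nat.add_sub_cancel] at h1
      rw [mul_comm h, ← h1, ← map_add, hby, homogeneousComponent_eq_self hxm]
    rw [this]
    exact Submodule.add_mem_sup
      ⟨homogeneousComponent_mem_of_mem h𝔟 hb _, homogeneousComponent_isHomogeneous _ _⟩
      ⟨_, homogeneousComponent_isHomogeneous _ _, rfl⟩
  · refine sup_le (inf_le_inf_right _ fun x hx => Ideal.mem_sup_left hx) ?_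
    rintro _ ⟨x, hx, rfl⟩
    refine ⟨Ideal.mem_sup_right (Ideal.mul_mem_right _ _ (Ideal.mem_span_singleton_self h)), ?_⟩
    have : (h * x).IsHomogeneous (1 + m) := hh.mul hx
    rw [add_comm] at this
    exact this

/-- The Hilbert function of a homogeneous ideal enlarged by a linear form which is regular in
degree `m` modulo that ideal. -/
theorem finrank_idealDegreePart_sup_span_singleton [Finite σ] {h : MvPolynomial σ k}
    (hh : h.IsHomogeneous 1) {𝔟 : Ideal (MvPolynomial σ k)}
    (h𝔟 : 𝔟.IsHomogeneous (homogeneousSubmodule σ k)) {m : ℕ}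
    (hreg : ∀ x, x.IsHomogeneous m → h * x ∈ 𝔟 → x ∈ 𝔟) :
    Module.finrank k (idealDegreePart (𝔟 ⊔ Ideal.span {h}) (m + 1)) +
        Module.finrank k (idealDegreePart 𝔟 m) =
      Module.finrank k (idealDegreePart 𝔟 (m + 1)) +
        Module.finrank k (homogeneousSubmodule σ k m) := by
  rcases eq_or_ne h 0 with rfl | h0
  · have : idealDegreePart 𝔟 m = homogeneousSubmodule σ k m :=
      inf_eq_right.2 fun x hx => hreg x hx (by simp)
    rw [this, Ideal.span_singleton_eq_bot.2 rfl, sup_bot_eq]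
  · have hinj : Function.Injective (LinearMap.mulLeft k h) := mul_right_injective₀ h0
    have hinf : idealDegreePart 𝔟 (m + 1) ⊓
        (homogeneousSubmodule σ k m).map (LinearMap.mulLeft k h) =
        (idealDegreePart 𝔟 m).map (LinearMap.mulLeft k h) := by
      apply le_antisymm
      · rintro _ ⟨⟨hx, _⟩, x, hxm, rfl⟩
        exact ⟨x, ⟨hreg x hxm hx, hxm⟩, rfl⟩
      · rintro _ ⟨x, ⟨hx, hxm⟩, rfl⟩
        refine ⟨⟨Ideal.mul_mem_left _ _ hx, ?_⟩, x, hxm, rfl⟩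
        have : (h * x).IsHomogeneous (1 + m) := hh.mul hxm
        rw [add_comm] at this
        exact this
    have key := Submodule.finrank_sup_add_finrank_inf_eq (idealDegreePart 𝔟 (m + 1))
      ((homogeneousSubmodule σ k m).map (LinearMap.mulLeft k h))
    rw [hinf, ← idealDegreePart_sup_span_singleton hh h𝔟 m,
      LinearEquiv.finrank_eq (Submodule.equivMapOfInjective _ hinj _).symm,
      LinearEquiv.finrank_eq (Submodule.equivMapOfInjective _ hinj _).symm] at key
    exact key

end MvPolynomial

end

section

open MvPolynomial
open scoped Pointwise

attribute [local instance] MvPolynomial.gradedAlgebra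

theorem reesHilbFnSection_add_finrank {d n : ℕ} (k : Type) [Field k] (δ : ℕ)
    (f : Fin (n + 1) → MvPolynomial (Fin (d + 1)) k) (𝔞 : Ideal (MvPolynomial (Fin (d + 1)) k))
    (j q : ℕ) :
    reesHilbFnSection k δ f 𝔞 j q + Module.finrank k (idealDegreePart 𝔞 (j + q * δ)) =
      Module.finrank k (idealDegreePart (Ideal.span (Set.range f) ^ q ⊔ 𝔞) (j + q * δ)) := by
  unfold reesHilbFnSection
  set I := Ideal.span (Set.range f)
  set m := j + q * δ
  have hmap : (((I.map (Ideal.Quotient.mk 𝔞)) ^ q).restrictScalars k ⊓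
      Submodule.map (Ideal.Quotient.mkₐ k 𝔞).toLinearMap (homogeneousSubmodule (Fin (d + 1)) k m)) =
      (idealDegreePart (I ^ q ⊔ 𝔞) m).map (Ideal.Quotient.mkₐ k 𝔞).toLinearMap := by
    have hmem : ∀ x, Ideal.Quotient.mk 𝔞 x ∈ (I.map (Ideal.Quotient.mk 𝔞)) ^ q ↔
        x ∈ I ^ q ⊔ 𝔞 := by
      intro x
      rw [← Ideal.map_pow, ← Ideal.mem_comap,
        Ideal.comap_map_of_surjective _ Ideal.Quotient.mk_surjective, ← RingHom.ker_eq_comap_bot,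
        Ideal.mk_ker]
    apply le_antisymm
    · rintro _ ⟨hx, x, hxm, rfl⟩
      exact ⟨x, ⟨(hmem x).1 hx, hxm⟩, rfl⟩
    · rintro _ ⟨x, ⟨hx, hxm⟩, rfl⟩
      exact ⟨(hmem x).2 hx, x, hxm, rfl⟩
  rw [hmap]
  have key := LinearMap.finrank_range_add_finrank_ker
    ((Ideal.Quotient.mkₐ k 𝔞).toLinearMap.domRestrict (idealDegreePart (I ^ q ⊔ 𝔞) m))
  rw [LinearMap.range_domRestrict] at key
  rw [← key]
  congr 1
  have hker : (LinearMap.ker ((Ideal.Quotient.mkₐ k 𝔞).toLinearMap.domRestrict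
      (idealDegreePart (I ^ q ⊔ 𝔞) m))).map (Submodule.subtype _) = idealDegreePart 𝔞 m := by
    apply le_antisymm
    · rintro _ ⟨x, hx, rfl⟩
      exact ⟨Ideal.Quotient.eq_zero_iff_mem.1 hx, x.2.2⟩
    · rintro x ⟨hx, hxm⟩
      exact ⟨⟨x, Ideal.mem_sup_right hx, hxm⟩, Ideal.Quotient.eq_zero_iff_mem.2 hx, rfl⟩
  rw [← hker]
  exact (LinearEquiv.finrank_eq
    (Submodule.equivMapOfInjective _ (Submodule.injective_subtype _) _)).symm

theorem reesHilbFnSection_bot {d n : ℕ} (k : Type) [Field k] (δ : ℕ)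
    (f : Fin (n + 1) → MvPolynomial (Fin (d + 1)) k) (j q : ℕ) :
    reesHilbFnSection k δ f ⊥ j q = reesHilbFn k δ f j q := by
  have h := reesHilbFnSection_add_finrank k δ f ⊥ j q
  have h0 : idealDegreePart (⊥ : Ideal (MvPolynomial (Fin (d + 1)) k)) (j + q * δ) = ⊥ :=
    bot_inf_eq _
  rw [h0, finrank_bot, add_zero, sup_bot_eq] at h
  exact h

/-- Cutting by a suitable linear form replaces the bigraded Hilbert function of the Rees algebra
by its first difference in the first variable. -/
theorem exists_linearForm_reesHilbFnSection {d n : ℕ} (k : Type) [Field k] [Infinite k] {δ : ℕ}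
    {f : Fin (n + 1) → MvPolynomial (Fin (d + 1)) k} (hf : ∀ j, (f j).IsHomogeneous δ)
    {𝔞 : Ideal (MvPolynomial (Fin (d + 1)) k)}
    (h𝔞 : 𝔞.IsHomogeneous (homogeneousSubmodule (Fin (d + 1)) k)) :
    ∃ h : MvPolynomial (Fin (d + 1)) k, h.IsHomogeneous 1 ∧ ∃ c : ℕ, ∀ j q, c ≤ j →
      reesHilbFnSection k δ f (𝔞 ⊔ Ideal.span {h}) (j + 1) q + reesHilbFnSection k δ f 𝔞 j q =
        reesHilbFnSection k δ f 𝔞 (j + 1) q := by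
  obtain ⟨h, hh, c, hc⟩ := exists_linearForm_filterRegular hf h𝔞
  refine ⟨h, hh, c, fun j q hj => ?_⟩
  have hI : (Ideal.span (Set.range f) ^ q ⊔ 𝔞).IsHomogeneous
        (homogeneousSubmodule (Fin (d + 1)) k) := by
    refine Ideal.IsHomogeneous.sup ?_ h𝔞
    have hspan : Ideal.span (Set.range f) ^ q = Ideal.span (Set.range f ^ q) :=
      Submodule.span_pow (Set.range f) q
    rw [hspan]
    exact Ideal.homogeneous_span _ _ fun g hg => ⟨_, isHomogeneous_of_mem_range_pow hf q g hg⟩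
  have e₁ := reesHilbFnSection_add_finrank k δ f (𝔞 ⊔ Ideal.span {h}) (j + 1) q
  have e₂ := reesHilbFnSection_add_finrank k δ f 𝔞 (j + 1) q
  have e₃ := reesHilbFnSection_add_finrank k δ f 𝔞 j q
  have e₄ := finrank_idealDegreePart_sup_span_singleton hh h𝔞 (m := j + q * δ)
    fun x hx => (hc _ x hx).2 (by omega)
  have e₅ := finrank_idealDegreePart_sup_span_singleton hh hI (m := j + q * δ)
    fun x hx => (hc _ x hx).1 q (by omega)
  rw [show j + 1 + q * δ = j + q * δ + 1 by ring] at e₁ e₂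
  rw [← sup_assoc] at e₁
  omega

end

section

open MvPolynomial

theorem Finsupp.single_zero_add_single_one_inj {a b a' b' : ℕ} :
    (Finsupp.single (0 : Fin 2) a + Finsupp.single (1 : Fin 2) b =
      Finsupp.single (0 : Fin 2) a' + Finsupp.single (1 : Fin 2) b') ↔ a = a' ∧ b = b' := by
  constructor
  · intro h
    have h0 := DFunLike.congr_fun h 0
    have h1 := DFunLike.congr_fun h 1
    simp at h0 h1
    exact ⟨h0, h1⟩
  · rintro ⟨rfl, rfl⟩; rfl

theorem Finsupp.exists_eq_single_zero_add_single_one (s : Fin 2 →₀ ℕ) :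
    s = Finsupp.single (0 : Fin 2) (s 0) + Finsupp.single (1 : Fin 2) (s 1) := by
  ext i
  fin_cases i <;> simp

/-- The backward difference in the first variable of a polynomial in two variables. -/
theorem MvPolynomial.exists_backwardDifference (e : ℕ) (P : MvPolynomial (Fin 2) ℚ)
    (hP : P.totalDegree ≤ e + 1) :
    ∃ Q : MvPolynomial (Fin 2) ℚ, Q.totalDegree ≤ e ∧
      (∀ x y : ℚ, eval ![x, y] Q = eval ![x, y] P - eval ![x - 1, y] P) ∧
      ∀ a b : ℕ, a + b = e →
        coeff (Finsupp.single (0 : Fin 2) a + Finsupp.single (1 : Fin 2) b) Q =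
          (a + 1) * coeff (Finsupp.single (0 : Fin 2) (a + 1) + Finsupp.single (1 : Fin 2) b) P := by
  have hmon : ∀ s : Fin 2 →₀ ℕ, s.degree ≤ e + 1 →
      ∃ Q : MvPolynomial (Fin 2) ℚ, Q.totalDegree ≤ e ∧
      (∀ x y : ℚ, eval ![x, y] Q = x ^ s 0 * y ^ s 1 - (x - 1) ^ s 0 * y ^ s 1) ∧
      ∀ a b : ℕ, a + b = e →
        coeff (Finsupp.single (0 : Fin 2) a + Finsupp.single (1 : Fin 2) b) Q =
          if s = Finsupp.single (0 : Fin 2) (a + 1) + Finsupp.single (1 : Fin 2) b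
          then (a : ℚ) + 1 else 0 := by
    intro s hs
    rw [Finsupp.exists_eq_single_zero_add_single_one s] at hs ⊢
    generalize s 0 = r at *
    generalize s 1 = t at *
    have hrt : r + t ≤ e + 1 := by
      rwa [map_add, Finsupp.degree_single, Finsupp.degree_single] at hs
    refine ⟨∑ l ∈ Finset.range r, monomial (Finsupp.single (0 : Fin 2) l +
      Finsupp.single (1 : Fin 2) t) (-((-1) ^ (r - l) * (r.choose l : ℚ))), ?_, ?_, ?_⟩
    · refine (totalDegree_finsetSum _ _).trans (Finset.sup_le fun l hl => ?_)
      refine (totalDegree_monomial_le _ _).trans ?_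
      have := Finset.mem_range.1 hl
      change Finsupp.degree _ ≤ e
      rw [map_add, Finsupp.degree_single, Finsupp.degree_single]
      omega
    · intro x y
      have hb := (Commute.all x (-1)).add_pow r
      rw [Finset.sum_range_succ] at hb
      have hterm : ∀ l, eval ![x, y] (monomial (Finsupp.single (0 : Fin 2) l +
          Finsupp.single (1 : Fin 2) t) (-((-1) ^ (r - l) * (r.choose l : ℚ)))) =
          -(x ^ l * (-1) ^ (r - l) * (r.choose l : ℚ)) * y ^ t := by
        intro l
        rw [eval_monomial, Finsupp.prod_add_index' (by simp) (by simp [pow_add]),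
          Finsupp.prod_single_index (by simp), Finsupp.prod_single_index (by simp)]
        simp
        ring
      simp only [map_sum, hterm]
      rw [← Finset.sum_mul, Finset.sum_neg_distrib]
      simp only [Nat.sub_self, pow_zero, mul_one, Nat.choose_self, Nat.cast_one] at hb
      rw [← sub_eq_add_neg] at hb
      simp
      rw [hb]
      ring
    · intro a b hab
      simp only [coeff_sum, coeff_monomial, Finsupp.single_zero_add_single_one_inj]
      split_ifs with h
      · obtain ⟨rfl, rfl⟩ := h
        rw [Finset.sum_eq_single a]
        · simp
        · intro l _ hl; simp [hl]
        · simp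
      · refine Finset.sum_eq_zero fun l hl => if_neg ?_
        rintro ⟨rfl, rfl⟩
        have := Finset.mem_range.1 hl
        exact h ⟨by omega, rfl⟩
  choose! Q hQdeg hQeval hQcoeff using hmon
  have hsupp : ∀ s ∈ P.support, s.degree ≤ e + 1 := fun s hs => (le_totalDegree hs).trans hP
  refine ⟨∑ s ∈ P.support, C (coeff s P) * Q s, ?_, ?_, ?_⟩
  · refine (totalDegree_finsetSum _ _).trans (Finset.sup_le fun s hs => ?_)
    refine (totalDegree_mul _ _).trans ?_
    rw [totalDegree_C, zero_add]
    exact hQdeg s (hsupp s hs)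
  · intro x y
    rw [eval_eq' ![x, y] P, eval_eq' ![x - 1, y] P, ← Finset.sum_sub_distrib, map_sum]
    refine Finset.sum_congr rfl fun s hs => ?_
    rw [map_mul, eval_C, hQeval s (hsupp s hs)]
    simp
    ring
  · intro a b hab
    rw [coeff_sum]
    have : ∀ s ∈ P.support, coeff (Finsupp.single (0 : Fin 2) a + Finsupp.single (1 : Fin 2) b)
        (C (coeff s P) * Q s) =
        if s = Finsupp.single (0 : Fin 2) (a + 1) + Finsupp.single (1 : Fin 2) b
          then ((a : ℚ) + 1) * coeff s P else 0 := by
      intro s hs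
      rw [coeff_C_mul, hQcoeff s (hsupp s hs) a b hab, mul_ite, mul_zero, mul_comm]
    rw [Finset.sum_congr rfl this, Finset.sum_ite_eq']
    split_ifs with h
    · rfl
    · rw [notMem_support_iff.1 h, mul_zero]

end

section

open MvPolynomial

attribute [local instance] MvPolynomial.gradedAlgebra

theorem isBigradedHilbPoly_backwardDifference {H H' : ℕ → ℕ → ℕ} {P Q : MvPolynomial (Fin 2) ℚ}
    (hP : IsBigradedHilbPoly H P)
    (hQ : ∀ x y : ℚ, eval ![x, y] Q = eval ![x, y] P - eval ![x - 1, y] P) {c : ℕ}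
    (hH : ∀ j q, c ≤ j → H' (j + 1) q + H j q = H (j + 1) q) :
    IsBigradedHilbPoly H' Q := by
  obtain ⟨j₀, q₀, h⟩ := hP
  refine ⟨max c j₀ + 1, q₀, fun j q hj hq => ?_⟩
  obtain ⟨j, rfl⟩ : ∃ i, j = i + 1 := ⟨j - 1, by omega⟩
  have hc : c ≤ j := by omega
  have hj₀ : j₀ ≤ j := by omega
  have h₁ := h (j + 1) q (by omega) hq
  have h₂ := h j q hj₀ hq
  rw [hQ, h₁, show ((j + 1 : ℕ) : ℚ) - 1 = j by push_cast; ring, h₂, ← hH j q hc]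
  push_cast
  ring

/-- An infinite sequence of linear forms, each of which cuts the bigraded Hilbert function of the
Rees algebra down to its first difference. -/
theorem exists_linearForm_sequence {d n : ℕ} (k : Type) [Field k] [Infinite k] {δ : ℕ}
    {f : Fin (n + 1) → MvPolynomial (Fin (d + 1)) k} (hf : ∀ j, (f j).IsHomogeneous δ) :
    ∃ h : ℕ → MvPolynomial (Fin (d + 1)) k, (∀ i, (h i).IsHomogeneous 1) ∧
      ∀ i, ∃ c : ℕ, ∀ j q, c ≤ j →
        reesHilbFnSection k δ f (Ideal.span (h '' Set.Iio (i + 1))) (j + 1) q +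
          reesHilbFnSection k δ f (Ideal.span (h '' Set.Iio i)) j q =
        reesHilbFnSection k δ f (Ideal.span (h '' Set.Iio i)) (j + 1) q := by
  have hstep : ∀ 𝔞 : Ideal (MvPolynomial (Fin (d + 1)) k), ∃ h : MvPolynomial (Fin (d + 1)) k,
      h.IsHomogeneous 1 ∧ (𝔞.IsHomogeneous (homogeneousSubmodule (Fin (d + 1)) k) →
      ∃ c : ℕ, ∀ j q, c ≤ j →
      reesHilbFnSection k δ f (𝔞 ⊔ Ideal.span {h}) (j + 1) q + reesHilbFnSection k δ f 𝔞 j q =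
        reesHilbFnSection k δ f 𝔞 (j + 1) q) := by
    intro 𝔞
    by_cases h𝔞 : 𝔞.IsHomogeneous (homogeneousSubmodule (Fin (d + 1)) k)
    · obtain ⟨h, hh, hc⟩ := exists_linearForm_reesHilbFnSection k hf h𝔞
      exact ⟨h, hh, fun _ => hc⟩
    · exact ⟨0, isHomogeneous_zero _ _ _, fun h => absurd h h𝔞⟩
  choose g hg hgc using hstep
  let A : ℕ → Ideal (MvPolynomial (Fin (d + 1)) k) :=
    fun i => Nat.rec ⊥ (fun _ 𝔞 => 𝔞 ⊔ Ideal.span {g 𝔞}) i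
  have hA : ∀ i, Ideal.span ((fun i => g (A i)) '' Set.Iio i) = A i := by
    intro i
    induction i with
    | zero => simp [A]
    | succ i ih =>
      have hIio : Set.Iio (i + 1) = insert i (Set.Iio i) := by
        ext j
        simp only [Set.mem_Iio, Set.mem_insert_iff]
        omega
      rw [hIio, Set.image_insert_eq, Ideal.span_insert, ih, sup_comm]
  refine ⟨fun i => g (A i), fun i => hg _, fun i => ?_⟩
  rw [hA i, hA (i + 1)]
  refine hgc (A i) ?_
  rw [← hA i]
  refine Ideal.homogeneous_span _ _ ?_
  rintro _ ⟨j, _, rfl⟩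
  exact ⟨1, hg _⟩

end

section

variable {d : ℕ} (k : Type) [Field k]

/-- **Reduction of projective degrees to Rees algebras over linear sections**
(Proposition 5.5(i)).  If `k` is infinite, there are linear forms `h₁,…,h_d` such that for
each `0 ≤ i ≤ d`, setting `Sᵢ = R/(h₁,…,hᵢ)` and `Jᵢ = I·Sᵢ`, the bigraded Hilbert function
of the Rees algebra of `Jᵢ` agrees for `(j,q) ≫ (0,0)` with a polynomial `Pᵢ` of total
degree at most `d − i`, and `d_i(F) = (d−i)!` times the coefficient of `u⁰v^{d-i}` in `Pᵢ`;
that is, `d_i(F) = e(0, d−i; Rees_{Sᵢ}(Jᵢ))`. -/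
theorem projDeg_eq_mixedMult_rees_section
    [Infinite k]
    {n : ℕ} (hdn : d ≤ n) (δ : ℕ) (hδ : 0 < δ)
    (f : Fin (n + 1) → MvPolynomial (Fin (d + 1)) k)
    (hf : ∀ j, f j ≠ 0 ∧ (f j).IsHomogeneous δ)
    (P : MvPolynomial (Fin 2) ℚ)
    (hP : IsBigradedHilbPoly (reesHilbFn k δ f) P)
    (hPdeg : P.totalDegree = d) :
    ∃ h : Fin d → MvPolynomial (Fin (d + 1)) k,
      (∀ j, (h j).IsHomogeneous 1) ∧
      ∀ (i : ℕ) (hi : i ≤ d),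
        ∃ Pi : MvPolynomial (Fin 2) ℚ,
          Pi.totalDegree ≤ d - i ∧
          IsBigradedHilbPoly
            (reesHilbFnSection k δ f
              (Ideal.span (Set.range fun t : Fin i => h (Fin.castLE hi t)))) Pi ∧
          projDeg d P i =
            ((Nat.factorial (d - i) : ℚ)) *
              MvPolynomial.coeff (Finsupp.single (1 : Fin 2) (d - i)) Pi := by
  obtain ⟨h, hh, hcut⟩ := exists_linearForm_sequence k (fun j => (hf j).2)
  refine ⟨fun j => h j, fun j => hh j, fun i hi => ?_⟩
  have hrange : (Set.range fun t : Fin i => h (Fin.castLE hi t : Fin d)) = h '' Set.Iio i := by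
    ext x
    constructor
    · rintro ⟨t, rfl⟩
      exact ⟨t, t.2, rfl⟩
    · rintro ⟨t, ht, rfl⟩
      exact ⟨⟨t, ht⟩, rfl⟩
  rw [hrange]
  have key : ∀ i ≤ d, ∃ Pi : MvPolynomial (Fin 2) ℚ, Pi.totalDegree ≤ d - i ∧
      IsBigradedHilbPoly (reesHilbFnSection k δ f (Ideal.span (h '' Set.Iio i))) Pi ∧
      ∀ a b : ℕ, a + b = d - i →
        (Nat.factorial a : ℚ) *
            MvPolynomial.coeff (Finsupp.single (0 : Fin 2) a + Finsupp.single (1 : Fin 2) b) Pi =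
          (Nat.factorial (a + i) : ℚ) *
            MvPolynomial.coeff (Finsupp.single (0 : Fin 2) (a + i) + Finsupp.single (1 : Fin 2) b)
              P := by
    intro i
    induction i with
    | zero =>
      intro _
      refine ⟨P, hPdeg.le, ?_, fun a b _ => rfl⟩
      obtain ⟨j₀, q₀, H⟩ := hP
      refine ⟨j₀, q₀, fun j q hj hq => ?_⟩
      rw [H j q hj hq, ← reesHilbFnSection_bot]
      simp
    | succ i ih =>
      intro hid
      obtain ⟨Pi, hdeg, hPi, hcoeff⟩ := ih (by omega)
      obtain ⟨e, he⟩ : ∃ e, d - i = e + 1 := ⟨d - i - 1, by omega⟩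
      obtain ⟨Q, hQdeg, hQeval, hQcoeff⟩ := MvPolynomial.exists_backwardDifference e Pi (he ▸ hdeg)
      obtain ⟨c, hc⟩ := hcut i
      refine ⟨Q, by omega, isBigradedHilbPoly_backwardDifference hPi hQeval hc, fun a b hab => ?_⟩
      rw [hQcoeff a b (by omega), ← add_assoc, add_right_comm, ← hcoeff (a + 1) b (by omega),
        Nat.factorial_succ]
      push_cast
      ring
  obtain ⟨Pi, hdeg, hPi, hcoeff⟩ := key i hi
  refine ⟨Pi, hdeg, hPi, ?_⟩
  have h0 := hcoeff 0 (d - i) (by omega)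
  simp only [Nat.factorial_zero, Nat.cast_one, one_mul, Finsupp.single_zero, zero_add] at h0
  rw [h0, projDeg]
  ring

end
end
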